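/- For a G-coalgebra C̲, the following conditions are equivalent: (1) there exists a convolution invertible morphism u̲ : C̲ → k⟨G⟩ in (M_k)^G (i.e. linear maps u_α ∈ C_α*, v_α ∈ C_{α⁻¹}* with u_α(c_{(1,α)}) v_α(c_{(2,α⁻¹)}) = v_α(c_{(1,α⁻¹)}) u_α(c_{(2,α)}) = ε(c) for all c ∈ C_e) such that u_α(c_{(1,α)}) c_{(2,e)} = c_{(1,e)} u_α(c_{(2,α)}) for all α ∈ G and c ∈ C_α; (2) C̲ is isomorphic to a crossed coproduct C ⋊_f k⟨G⟩ with λ_α = id_C for all α ∈ G; (3) C̲ is isomorphic to a crossed coproduct C ⋊_f k⟨G⟩ with f normalized and λ_α = id_C for all α ∈ G; (4) C̲ is a strong G-coalgebra and every C_α is isomorphic to C_e as a C_e-bicomodule. -/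

import Mathlib

open TensorProduct

universe u

/-- A `G`-group coalgebra over `k`: a family of `k`-vector spaces `C α` with
comultiplications `Δ_{α,β} : C (α*β) → C α ⊗ C β` and a counit `ε : C 1 → k`.
The comultiplication takes an explicit proof `γ = α * β` to avoid dependent casts. -/
structure GCoalgebra (k : Type u) [Field k] (G : Type u) [Group G] where
  C : G → Type u
  [acg : ∀ α, AddCommGroup (C α)]
  [mod : ∀ α, Module k (C α)]
  Δ : ∀ ⦃γ⦄ (α β : G), γ = α * β → (C γ →ₗ[k] C α ⊗[k] C β)
  ε : C 1 →ₗ[k] k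
  coassoc : ∀ ⦃δ δ₁ δ₂ : G⦄ (α β γ : G) (h₁ : δ = δ₁ * γ) (h₁' : δ₁ = α * β)
      (h₂ : δ = α * δ₂) (h₂' : δ₂ = β * γ),
      (TensorProduct.assoc k (C α) (C β) (C γ)).toLinearMap ∘ₗ
        (TensorProduct.map (Δ α β h₁') LinearMap.id) ∘ₗ Δ δ₁ γ h₁
      = (TensorProduct.map LinearMap.id (Δ β γ h₂')) ∘ₗ Δ α δ₂ h₂
  counit_right : ∀ (α : G) (h : α = α * 1),
      (TensorProduct.rid k (C α)).toLinearMap ∘ₗ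
        (TensorProduct.map LinearMap.id ε) ∘ₗ Δ α 1 h = LinearMap.id
  counit_left : ∀ (α : G) (h : α = 1 * α),
      (TensorProduct.lid k (C α)).toLinearMap ∘ₗ
        (TensorProduct.map ε LinearMap.id) ∘ₗ Δ 1 α h = LinearMap.id

attribute [instance] GCoalgebra.acg GCoalgebra.mod

variable {k : Type u} [Field k] {G : Type u} [Group G]

/-- A right `G`-`C̲`-comodule. -/
structure GComodule (Cc : GCoalgebra k G) where
  M : G → Type u
  [acg : ∀ α, AddCommGroup (M α)]
  [mod : ∀ α, Module k (M α)]
  ρ : ∀ ⦃γ⦄ (α β : G), γ = α * β → (M γ →ₗ[k] M α ⊗[k] Cc.C β)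
  counit : ∀ (α : G) (h : α = α * 1),
      (TensorProduct.rid k (M α)).toLinearMap ∘ₗ
        (TensorProduct.map LinearMap.id Cc.ε) ∘ₗ ρ α 1 h = LinearMap.id
  coassoc : ∀ ⦃δ δ₁ δ₂ : G⦄ (α β γ : G) (h₁ : δ = δ₁ * γ) (h₁' : δ₁ = α * β)
      (h₂ : δ = α * δ₂) (h₂' : δ₂ = β * γ),
      (TensorProduct.assoc k (M α) (Cc.C β) (Cc.C γ)).toLinearMap ∘ₗ
        (TensorProduct.map (ρ α β h₁') LinearMap.id) ∘ₗ ρ δ₁ γ h₁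
      = (TensorProduct.map LinearMap.id (Cc.Δ β γ h₂')) ∘ₗ ρ α δ₂ h₂

attribute [instance] GComodule.acg GComodule.mod

/-- A morphism of right `G`-`C̲`-comodules. -/
structure GComodHom {Cc : GCoalgebra k G} (M N : GComodule Cc) where
  φ : ∀ α, M.M α →ₗ[k] N.M α
  colinear : ∀ ⦃γ⦄ (α β : G) (h : γ = α * β),
      (TensorProduct.map (φ α) LinearMap.id) ∘ₗ M.ρ α β h = N.ρ α β h ∘ₗ φ γ

/-- A `G`-coalgebra is strong if all comultiplication maps are injective. -/
def GCoalgebra.Strong (Cc : GCoalgebra k G) : Prop :=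
  ∀ (α β : G), Function.Injective (Cc.Δ α β rfl)
section Convolution

variable (k : Type u) [Field k] (C : Type u) [AddCommGroup C] [Module k C]
  [Coalgebra k C]

/-- Convolution of two functionals on a coalgebra: `(f * g)(c) = f(c₁) g(c₂)`. -/
noncomputable def convF (f g : C →ₗ[k] k) : C →ₗ[k] k :=
  LinearMap.mul' k k ∘ₗ TensorProduct.map f g ∘ₗ Coalgebra.comul

/-- `convFM f T : c ↦ f(c₁) T(c₂)`. -/
noncomputable def convFM (f : C →ₗ[k] k) (T : C →ₗ[k] C) : C →ₗ[k] C :=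
  (TensorProduct.lid k C).toLinearMap ∘ₗ TensorProduct.map f T ∘ₗ Coalgebra.comul

/-- `convMF T f : c ↦ T(c₁) f(c₂)`. -/
noncomputable def convMF (T : C →ₗ[k] C) (f : C →ₗ[k] k) : C →ₗ[k] C :=
  (TensorProduct.rid k C).toLinearMap ∘ₗ TensorProduct.map T f ∘ₗ Coalgebra.comul

end Convolution

/-- The data of a crossed coproduct: a `k`-coalgebra `C`, a family of coalgebra
endomorphisms `λ_α` of `C` (a weak `G`-action), and families of functionals
`f_{α,β}, g_{α,β} ∈ C*` (`g` recording the convolution inverses of `f`). -/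
structure CrossedData (k G : Type u) [Field k] [Group G] where
  C : Type u
  [acg : AddCommGroup C]
  [mod : Module k C]
  [coalg : Coalgebra k C]
  lam : G → (C →ₗc[k] C)
  f : G → G → (C →ₗ[k] k)
  g : G → G → (C →ₗ[k] k)

attribute [instance] CrossedData.acg CrossedData.mod CrossedData.coalg

namespace CrossedData

variable {k G : Type u} [Field k] [Group G] (D : CrossedData k G)

/-- `f_{e,e}` and `g_{e,e}` are convolution inverse to each other, and
`λ_e(c) = f_{e,e}(c₁) c₂ g_{e,e}(c₃)`. -/
def IsWeakData : Prop :=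
  convF k D.C (D.f 1 1) (D.g 1 1) = Coalgebra.counit ∧
  convF k D.C (D.g 1 1) (D.f 1 1) = Coalgebra.counit ∧
  (D.lam 1).toLinearMap =
    convMF k D.C (convFM k D.C (D.f 1 1) LinearMap.id) (D.g 1 1)

/-- Condition (CU): `f_{e,α} = f_{e,e}` and `f_{α,e} = f_{e,e} ∘ λ_α`. -/
def CondCU : Prop :=
  ∀ α : G, D.f 1 α = D.f 1 1 ∧ D.f α 1 = D.f 1 1 ∘ₗ (D.lam α).toLinearMap

/-- Condition (C), the cocycle condition:
`f_{β,γ}(λ_α(c₁)) f_{α,βγ}(c₂) = f_{α,β}(c₁) f_{αβ,γ}(c₂)`. -/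
def CondC : Prop :=
  ∀ α β γ : G,
    convF k D.C (D.f β γ ∘ₗ (D.lam α).toLinearMap) (D.f α (β * γ)) =
      convF k D.C (D.f α β) (D.f (α * β) γ)

/-- Condition (TC), the twisted-commutation condition:
`λ_β(λ_α(c₁)) f_{α,β}(c₂) = f_{α,β}(c₁) λ_{αβ}(c₂)`. -/
def CondTC : Prop :=
  ∀ α β : G,
    convMF k D.C ((D.lam β).toLinearMap ∘ₗ (D.lam α).toLinearMap) (D.f α β) =
      convFM k D.C (D.f α β) (D.lam (α * β)).toLinearMap

/-- `f` is a factor set: all `f_{α,β}` are convolution invertible (with inverses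
`g_{α,β}`) and the conditions of Proposition 3.1 hold. -/
def IsFactorSet : Prop :=
  D.IsWeakData ∧
  (∀ α β : G, convF k D.C (D.f α β) (D.g α β) = Coalgebra.counit ∧
    convF k D.C (D.g α β) (D.f α β) = Coalgebra.counit) ∧
  D.CondCU ∧ D.CondC ∧ D.CondTC

/-- `f` is normalized: `f_{α,e} = f_{e,α} = ε_C`. -/
def Normalized : Prop :=
  ∀ α : G, D.f α 1 = Coalgebra.counit ∧ D.f 1 α = Coalgebra.counit

/-- The comultiplication `δ_{α,β} : C → C ⊗ C` of the crossed coproduct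
`C ⋊_f k⟨G⟩` (identifying `C ⋊ p_α` with `C`):
`δ_{α,β}(c) = c₁ ⊗ λ_α(c₂) f_{α,β}(c₃)`. -/
noncomputable def delta (α β : G) : D.C →ₗ[k] D.C ⊗[k] D.C :=
  TensorProduct.map LinearMap.id
      (convMF k D.C (D.lam α).toLinearMap (D.f α β)) ∘ₗ Coalgebra.comul

/-- The `G`-coalgebra axioms for the (constant) family `C ⋊ p_α ≅ C` with the
crossed-coproduct structure maps `δ_{α,β}` and counit `g_{e,e}`. -/
def IsGCoalgebra : Prop :=
  (∀ α β γ : G,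
    (TensorProduct.assoc k D.C D.C D.C).toLinearMap ∘ₗ
      (TensorProduct.map (D.delta α β) LinearMap.id) ∘ₗ D.delta (α * β) γ
    = (TensorProduct.map LinearMap.id (D.delta β γ)) ∘ₗ D.delta α (β * γ)) ∧
  (∀ α : G,
    (TensorProduct.rid k D.C).toLinearMap ∘ₗ
      (TensorProduct.map LinearMap.id (D.g 1 1)) ∘ₗ D.delta α 1 = LinearMap.id) ∧
  (∀ α : G,
    (TensorProduct.lid k D.C).toLinearMap ∘ₗ
      (TensorProduct.map (D.g 1 1) LinearMap.id) ∘ₗ D.delta 1 α = LinearMap.id)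

end CrossedData
/-- A `G`-coalgebra `C̲` is cocleft if there is a convolution invertible morphism
`u̲ : C̲ → k⟨G⟩` in `(M_k)^G`, i.e. functionals `u_α ∈ C_α*` and `v_α ∈ C_{α⁻¹}*`
with `u_α(c_{(1,α)}) v_α(c_{(2,α⁻¹)}) = v_α(c_{(1,α⁻¹)}) u_α(c_{(2,α)}) = ε(c)`
for all `c ∈ C_e`. -/
def GCoalgebra.Cocleft {k G : Type u} [Field k] [Group G] (Cc : GCoalgebra k G) : Prop :=
  ∃ (u : ∀ α : G, Cc.C α →ₗ[k] k) (v : ∀ α : G, Cc.C α⁻¹ →ₗ[k] k),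
    ∀ α : G,
      LinearMap.mul' k k ∘ₗ TensorProduct.map (u α) (v α) ∘ₗ
          Cc.Δ α α⁻¹ (mul_inv_cancel α).symm = Cc.ε ∧
      LinearMap.mul' k k ∘ₗ TensorProduct.map (v α) (u α) ∘ₗ
          Cc.Δ α⁻¹ α (inv_mul_cancel α).symm = Cc.ε

/-- `C̲` is isomorphic, as a `G`-coalgebra, to the crossed coproduct `C ⋊_f k⟨G⟩`
determined by the crossed data `D`. -/
def IsoToCrossed {k G : Type u} [Field k] [Group G] (Cc : GCoalgebra k G)
    (D : CrossedData k G) : Prop :=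
  ∃ φ : ∀ α : G, Cc.C α ≃ₗ[k] D.C,
    (D.g 1 1 ∘ₗ (φ 1).toLinearMap = Cc.ε) ∧
    ∀ ⦃γ : G⦄ (α β : G) (h : γ = α * β),
      TensorProduct.map (φ α).toLinearMap (φ β).toLinearMap ∘ₗ Cc.Δ α β h
        = D.delta α β ∘ₗ (φ γ).toLinearMap

/-- `C_α` is isomorphic to `C_e` as a left `C_e`-comodule (left coactions `Δ_{e,α}`
and `Δ_{e,e}`). -/
def LeftCeIso {k G : Type u} [Field k] [Group G] (Cc : GCoalgebra k G) (α : G) : Prop :=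
  ∃ φ : Cc.C α ≃ₗ[k] Cc.C 1,
    Cc.Δ 1 1 (one_mul 1).symm ∘ₗ φ.toLinearMap
      = TensorProduct.map LinearMap.id φ.toLinearMap ∘ₗ Cc.Δ 1 α (one_mul α).symm
/-- `C_α` is isomorphic to `C_e` as a `C_e`-bicomodule (left coactions `Δ_{e,α}`,
`Δ_{e,e}`; right coactions `Δ_{α,e}`, `Δ_{e,e}`). -/
def BiCeIso {k G : Type u} [Field k] [Group G] (Cc : GCoalgebra k G) (α : G) : Prop :=
  ∃ φ : Cc.C α ≃ₗ[k] Cc.C 1,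
    (Cc.Δ 1 1 (one_mul 1).symm ∘ₗ φ.toLinearMap
      = TensorProduct.map LinearMap.id φ.toLinearMap ∘ₗ Cc.Δ 1 α (one_mul α).symm) ∧
    (Cc.Δ 1 1 (mul_one 1).symm ∘ₗ φ.toLinearMap
      = TensorProduct.map φ.toLinearMap LinearMap.id ∘ₗ Cc.Δ α 1 (mul_one α).symm)

section TensorLemmas

variable {R : Type u} [Field R] {A B X Y : Type u} [AddCommGroup A] [Module R A]
  [AddCommGroup B] [Module R B] [AddCommGroup X] [Module R X] [AddCommGroup Y] [Module R Y]

theorem map_lid_map (T : X →ₗ[R] Y) (u : A →ₗ[R] R) (h : B →ₗ[R] X) (t : A ⊗[R] B) :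
    T (TensorProduct.lid R X (TensorProduct.map u h t)) =
      TensorProduct.lid R Y (TensorProduct.map u (T ∘ₗ h) t) := by
  induction t with
  | zero => simp
  | tmul a b => simp
  | add s t hs ht => simp only [map_add, hs, ht]

theorem map_rid_map (T : X →ₗ[R] Y) (h : A →ₗ[R] X) (u : B →ₗ[R] R) (t : A ⊗[R] B) :
    T (TensorProduct.rid R X (TensorProduct.map h u t)) =
      TensorProduct.rid R Y (TensorProduct.map (T ∘ₗ h) u t) := by
  induction t with
  | zero => simp
  | tmul a b => simp
  | add s t hs ht => simp only [map_add, hs, ht]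

end TensorLemmas

namespace GCoalgebra

variable (Cc : GCoalgebra k G)

theorem coassoc_apply {δ δ₁ δ₂ : G} (α β γ : G) (h₁ : δ = δ₁ * γ) (h₁' : δ₁ = α * β)
    (h₂ : δ = α * δ₂) (h₂' : δ₂ = β * γ) {X Y X' Y' Z : Type u}
    [AddCommGroup X] [Module k X] [AddCommGroup Y] [Module k Y]
    [AddCommGroup X'] [Module k X'] [AddCommGroup Y'] [Module k Y']
    [AddCommGroup Z] [Module k Z]
    (N : X ⊗[k] Y →ₗ[k] Z) (P : Cc.C α ⊗[k] Cc.C β →ₗ[k] X) (H : Cc.C γ →ₗ[k] Y)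
    (N' : X' ⊗[k] Y' →ₗ[k] Z) (F : Cc.C α →ₗ[k] X') (Q : Cc.C β ⊗[k] Cc.C γ →ₗ[k] Y')
    (hyp : ∀ a b c, N (P (a ⊗ₜ b) ⊗ₜ H c) = N' (F a ⊗ₜ Q (b ⊗ₜ c))) (c : Cc.C δ) :
    N (TensorProduct.map (P ∘ₗ Cc.Δ α β h₁') H (Cc.Δ δ₁ γ h₁ c)) =
      N' (TensorProduct.map F (Q ∘ₗ Cc.Δ β γ h₂') (Cc.Δ α δ₂ h₂ c)) := by
  have hW : N ∘ₗ TensorProduct.map P H = N' ∘ₗ TensorProduct.map F Q ∘ₗ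
      (TensorProduct.assoc k (Cc.C α) (Cc.C β) (Cc.C γ)).toLinearMap :=
    TensorProduct.ext_threefold fun a b c => by simpa using hyp a b c
  have e₁ : TensorProduct.map (P ∘ₗ Cc.Δ α β h₁') H =
      TensorProduct.map P H ∘ₗ TensorProduct.map (Cc.Δ α β h₁') LinearMap.id := by
    rw [← TensorProduct.map_comp, LinearMap.comp_id]
  have e₂ : TensorProduct.map F (Q ∘ₗ Cc.Δ β γ h₂') =
      TensorProduct.map F Q ∘ₗ TensorProduct.map LinearMap.id (Cc.Δ β γ h₂') := by
    rw [← TensorProduct.map_comp, LinearMap.comp_id]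
  have hc := LinearMap.congr_fun (Cc.coassoc α β γ h₁ h₁' h₂ h₂') c
  rw [e₁, e₂]
  have hW' := LinearMap.congr_fun hW
    (TensorProduct.map (Cc.Δ α β h₁') LinearMap.id (Cc.Δ δ₁ γ h₁ c))
  simp only [LinearMap.comp_apply, LinearEquiv.coe_coe] at hW' hc ⊢
  rw [hW', hc]

theorem lid_counit_apply {α : G} (h : α = 1 * α) (c : Cc.C α) :
    TensorProduct.lid k (Cc.C α) (TensorProduct.map Cc.ε LinearMap.id (Cc.Δ 1 α h c)) = c :=
  LinearMap.congr_fun (Cc.counit_left α h) c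

theorem rid_counit_apply {α : G} (h : α = α * 1) (c : Cc.C α) :
    TensorProduct.rid k (Cc.C α) (TensorProduct.map LinearMap.id Cc.ε (Cc.Δ α 1 h c)) = c :=
  LinearMap.congr_fun (Cc.counit_right α h) c

/-- The component at the identity of a `G`-coalgebra is a coalgebra. -/
noncomputable instance coalgebraOne : Coalgebra k (Cc.C 1) where
  comul := Cc.Δ 1 1 (one_mul 1).symm
  counit := Cc.ε
  coassoc := Cc.coassoc 1 1 1 _ _ _ _
  rTensor_counit_comp_comul := by
    ext c
    apply (TensorProduct.lid k (Cc.C 1)).injective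
    simpa [LinearMap.rTensor] using Cc.lid_counit_apply (one_mul 1).symm c
  lTensor_counit_comp_comul := by
    ext c
    apply (TensorProduct.rid k (Cc.C 1)).injective
    simpa [LinearMap.lTensor] using Cc.rid_counit_apply (one_mul 1).symm c

end GCoalgebra

section Convolution

variable {C : Type u} [AddCommGroup C] [Module k C] [Coalgebra k C]

theorem convF_counit (f : C →ₗ[k] k) : convF k C f Coalgebra.counit = f := by
  ext c
  have h := congrArg (fun t => f (TensorProduct.rid k C t)) (Coalgebra.lTensor_counit_comul (R := k) c)
  have h' := map_rid_map f LinearMap.id (Coalgebra.counit (R := k)) (Coalgebra.comul (R := k) c)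
  simp only [LinearMap.lTensor, TensorProduct.rid_tmul, one_smul] at h
  rw [← h, h']
  rw [LinearMap.comp_id]
  simp only [convF, LinearMap.comp_apply]
  generalize TensorProduct.map f Coalgebra.counit (Coalgebra.comul (R := k) c) = t
  induction t with
  | zero => simp
  | tmul a b => simp [mul_comm]
  | add s t hs ht => simp only [map_add, hs, ht]

theorem counit_convF (f : C →ₗ[k] k) : convF k C Coalgebra.counit f = f := by
  ext c
  have h := congrArg (fun t => f (TensorProduct.lid k C t)) (Coalgebra.rTensor_counit_comul (R := k) c)
  have h' := map_lid_map f (Coalgebra.counit (R := k)) LinearMap.id (Coalgebra.comul (R := k) c)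
  simp only [LinearMap.rTensor, TensorProduct.lid_tmul, one_smul] at h
  rw [← h, h']
  rw [LinearMap.comp_id]
  simp only [convF, LinearMap.comp_apply]
  generalize TensorProduct.map Coalgebra.counit f (Coalgebra.comul (R := k) c) = t
  induction t with
  | zero => simp
  | tmul a b => simp
  | add s t hs ht => simp only [map_add, hs, ht]

theorem convMF_counit (T : C →ₗ[k] C) : convMF k C T Coalgebra.counit = T := by
  ext c
  have h := congrArg (fun t => T (TensorProduct.rid k C t)) (Coalgebra.lTensor_counit_comul (R := k) c)
  have h' := map_rid_map T LinearMap.id (Coalgebra.counit (R := k)) (Coalgebra.comul (R := k) c)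
  simp only [LinearMap.lTensor, TensorProduct.rid_tmul, one_smul] at h
  rw [← h, h', LinearMap.comp_id]
  simp [convMF]

theorem counit_convFM (T : C →ₗ[k] C) : convFM k C Coalgebra.counit T = T := by
  ext c
  have h := congrArg (fun t => T (TensorProduct.lid k C t)) (Coalgebra.rTensor_counit_comul (R := k) c)
  have h' := map_lid_map T (Coalgebra.counit (R := k)) LinearMap.id (Coalgebra.comul (R := k) c)
  simp only [LinearMap.rTensor, TensorProduct.lid_tmul, one_smul] at h
  rw [← h, h', LinearMap.comp_id]
  simp [convFM]

theorem comp_convMF_id (b f : C →ₗ[k] k) : b ∘ₗ convMF k C LinearMap.id f = convF k C b f := by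
  ext c
  have h := map_rid_map b LinearMap.id f (Coalgebra.comul (R := k) c)
  simp only [convMF, convF, LinearMap.comp_apply, LinearEquiv.coe_coe]
  rw [h, LinearMap.comp_id]
  generalize TensorProduct.map b f (Coalgebra.comul (R := k) c) = t
  induction t with
  | zero => simp
  | tmul a b => simp [mul_comm]
  | add s t hs ht => simp only [map_add, hs, ht]

theorem comp_convFM_id (b f : C →ₗ[k] k) : b ∘ₗ convFM k C f LinearMap.id = convF k C f b := by
  ext c
  have h := map_lid_map b f LinearMap.id (Coalgebra.comul (R := k) c)
  simp only [convFM, convF, LinearMap.comp_apply, LinearEquiv.coe_coe]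
  rw [h, LinearMap.comp_id]
  generalize TensorProduct.map f b (Coalgebra.comul (R := k) c) = t
  induction t with
  | zero => simp
  | tmul a b => simp
  | add s t hs ht => simp only [map_add, hs, ht]

theorem convF_assoc (a b c : C →ₗ[k] k) :
    convF k C (convF k C a b) c = convF k C a (convF k C b c) := by
  have hW : LinearMap.mul' k k ∘ₗ TensorProduct.map (LinearMap.mul' k k ∘ₗ TensorProduct.map a b) c
      = LinearMap.mul' k k ∘ₗ TensorProduct.map a (LinearMap.mul' k k ∘ₗ TensorProduct.map b c) ∘ₗ
        (TensorProduct.assoc k C C C).toLinearMap :=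
    TensorProduct.ext_threefold fun x y z => by simp [mul_assoc]
  have e₁ : convF k C (convF k C a b) c =
      (LinearMap.mul' k k ∘ₗ TensorProduct.map (LinearMap.mul' k k ∘ₗ TensorProduct.map a b) c) ∘ₗ
        Coalgebra.comul.rTensor C ∘ₗ Coalgebra.comul := by
    rw [← LinearMap.comp_assoc, LinearMap.comp_assoc (LinearMap.rTensor _ _), LinearMap.rTensor,
      ← TensorProduct.map_comp]
    rfl
  have e₂ : convF k C a (convF k C b c) =
      (LinearMap.mul' k k ∘ₗ TensorProduct.map a (LinearMap.mul' k k ∘ₗ TensorProduct.map b c)) ∘ₗ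
        Coalgebra.comul.lTensor C ∘ₗ Coalgebra.comul := by
    rw [← LinearMap.comp_assoc, LinearMap.comp_assoc (LinearMap.lTensor _ _), LinearMap.lTensor,
      ← TensorProduct.map_comp]
    rfl
  rw [e₁, e₂, hW, ← Coalgebra.coassoc]
  rfl

/-- A linear endomorphism of a coalgebra that is colinear on both sides. -/
structure IsBicolinear (T : C →ₗ[k] C) : Prop where
  left : Coalgebra.comul ∘ₗ T = TensorProduct.map LinearMap.id T ∘ₗ Coalgebra.comul
  right : Coalgebra.comul ∘ₗ T = TensorProduct.map T LinearMap.id ∘ₗ Coalgebra.comul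

namespace IsBicolinear

variable {S T : C →ₗ[k] C}

theorem convMF_id (hT : IsBicolinear T) :
    convMF k C LinearMap.id (Coalgebra.counit ∘ₗ T) = T := by
  have h := congrArg (· ∘ₗ T) (convMF_counit (k := k) (LinearMap.id : C →ₗ[k] C))
  simp only [convMF, LinearMap.comp_assoc, hT.left, LinearMap.id_comp] at h
  rw [← LinearMap.comp_assoc Coalgebra.comul, ← TensorProduct.map_comp] at h
  simpa [convMF] using h

theorem convFM_id (hT : IsBicolinear T) :
    convFM k C (Coalgebra.counit ∘ₗ T) LinearMap.id = T := by
  have h := congrArg (· ∘ₗ T) (counit_convFM (k := k) (LinearMap.id : C →ₗ[k] C))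
  simp only [convFM, LinearMap.comp_assoc, hT.right, LinearMap.id_comp] at h
  rw [← LinearMap.comp_assoc Coalgebra.comul, ← TensorProduct.map_comp] at h
  simpa [convFM] using h

theorem convF_comp_counit (hT : IsBicolinear T) :
    convF k C (Coalgebra.counit ∘ₗ S) (Coalgebra.counit ∘ₗ T) = Coalgebra.counit ∘ₗ S ∘ₗ T := by
  rw [← comp_convMF_id, hT.convMF_id, LinearMap.comp_assoc]

theorem exists_convF_inverse (hT : IsBicolinear T) (hi : Function.Injective T) :
    ∃ g : C →ₗ[k] k, convF k C (Coalgebra.counit ∘ₗ T) g = Coalgebra.counit ∧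
      convF k C g (Coalgebra.counit ∘ₗ T) = Coalgebra.counit := by
  obtain ⟨r, hr⟩ := LinearMap.exists_leftInverse_of_injective T (LinearMap.ker_eq_bot.mpr hi)
  refine ⟨Coalgebra.counit ∘ₗ r, ?_, ?_⟩
  · rw [← comp_convFM_id, hT.convFM_id, LinearMap.comp_assoc, hr, LinearMap.comp_id]
  · rw [← comp_convMF_id, hT.convMF_id, LinearMap.comp_assoc, hr, LinearMap.comp_id]

end IsBicolinear

end Convolution

namespace GCoalgebra

variable (Cc : GCoalgebra k G)

/-- The slice `c ↦ u(c_{(1,α)}) T(c_{(2,β)})`. -/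
noncomputable def sliceLeft {α β γ : G} (h : γ = α * β) {X : Type u} [AddCommGroup X] [Module k X]
    (u : Cc.C α →ₗ[k] k) (T : Cc.C β →ₗ[k] X) : Cc.C γ →ₗ[k] X :=
  (TensorProduct.lid k X).toLinearMap ∘ₗ TensorProduct.map u T ∘ₗ Cc.Δ α β h

/-- The slice `c ↦ T(c_{(1,α)}) u(c_{(2,β)})`. -/
noncomputable def sliceRight {α β γ : G} (h : γ = α * β) {X : Type u} [AddCommGroup X]
    [Module k X] (T : Cc.C α →ₗ[k] X) (u : Cc.C β →ₗ[k] k) : Cc.C γ →ₗ[k] X :=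
  (TensorProduct.rid k X).toLinearMap ∘ₗ TensorProduct.map T u ∘ₗ Cc.Δ α β h

variable {Cc} {X Y : Type u} [AddCommGroup X] [Module k X] [AddCommGroup Y] [Module k Y]

theorem comp_sliceLeft {α β γ : G} (h : γ = α * β) (S : X →ₗ[k] Y) (u : Cc.C α →ₗ[k] k)
    (T : Cc.C β →ₗ[k] X) : S ∘ₗ Cc.sliceLeft h u T = Cc.sliceLeft h u (S ∘ₗ T) :=
  LinearMap.ext fun _ => map_lid_map _ _ _ _

theorem comp_sliceRight {α β γ : G} (h : γ = α * β) (S : X →ₗ[k] Y) (T : Cc.C α →ₗ[k] X)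
    (u : Cc.C β →ₗ[k] k) : S ∘ₗ Cc.sliceRight h T u = Cc.sliceRight h (S ∘ₗ T) u :=
  LinearMap.ext fun _ => map_rid_map _ _ _ _

theorem sliceLeft_eq_sliceRight {α β γ : G} (h : γ = α * β) (u : Cc.C α →ₗ[k] k)
    (w : Cc.C β →ₗ[k] k) : Cc.sliceLeft h u w = Cc.sliceRight h u w := by
  have : (TensorProduct.lid k k).toLinearMap = (TensorProduct.rid k k).toLinearMap :=
    TensorProduct.ext' fun a b => by simp [mul_comm]
  rw [sliceLeft, sliceRight, this]

theorem mul'_comp_map {α β γ : G} (h : γ = α * β) (u : Cc.C α →ₗ[k] k) (w : Cc.C β →ₗ[k] k) :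
    LinearMap.mul' k k ∘ₗ TensorProduct.map u w ∘ₗ Cc.Δ α β h = Cc.sliceLeft h u w := by
  have : (TensorProduct.lid k k).toLinearMap = LinearMap.mul' k k :=
    TensorProduct.ext' fun a b => by simp
  rw [sliceLeft, this]

theorem sliceLeft_counit {β : G} (h : β = 1 * β) (T : Cc.C β →ₗ[k] X) :
    Cc.sliceLeft h Cc.ε T = T := by
  have := comp_sliceLeft h T Cc.ε LinearMap.id
  rw [LinearMap.comp_id] at this
  rw [← this, sliceLeft, Cc.counit_left, LinearMap.comp_id]

theorem sliceLeft_sliceLeft {δ δ₁ δ₂ α β γ : G} (h₁ : δ = δ₁ * γ) (h₁' : δ₁ = α * β)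
    (h₂ : δ = α * δ₂) (h₂' : δ₂ = β * γ) (u : Cc.C α →ₗ[k] k) (w : Cc.C β →ₗ[k] k)
    (T : Cc.C γ →ₗ[k] X) :
    Cc.sliceLeft h₂ u (Cc.sliceLeft h₂' w T) = Cc.sliceLeft h₁ (Cc.sliceLeft h₁' u w) T :=
  LinearMap.ext fun c => (Cc.coassoc_apply α β γ h₁ h₁' h₂ h₂'
    (TensorProduct.lid k X).toLinearMap
    ((TensorProduct.lid k k).toLinearMap ∘ₗ TensorProduct.map u w) T
    (TensorProduct.lid k X).toLinearMap u
    ((TensorProduct.lid k X).toLinearMap ∘ₗ TensorProduct.map w T)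
    (fun a b c => by simp [smul_smul, mul_comm]) c).symm

theorem sliceRight_sliceLeft {δ δ₁ δ₂ α β γ : G} (h₁ : δ = δ₁ * γ) (h₁' : δ₁ = α * β)
    (h₂ : δ = α * δ₂) (h₂' : δ₂ = β * γ) (u : Cc.C α →ₗ[k] k) (T : Cc.C β →ₗ[k] X)
    (w : Cc.C γ →ₗ[k] k) :
    Cc.sliceRight h₁ (Cc.sliceLeft h₁' u T) w = Cc.sliceLeft h₂ u (Cc.sliceRight h₂' T w) :=
  LinearMap.ext fun c => Cc.coassoc_apply α β γ h₁ h₁' h₂ h₂'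
    (TensorProduct.rid k X).toLinearMap
    ((TensorProduct.lid k X).toLinearMap ∘ₗ TensorProduct.map u T) w
    (TensorProduct.lid k X).toLinearMap u
    ((TensorProduct.rid k X).toLinearMap ∘ₗ TensorProduct.map T w)
    (fun a b c => by simp [smul_smul, mul_comm]) c

theorem map_sliceLeft_comul {δ δ₁ δ₂ α β γ : G} (h₁ : δ = δ₁ * γ) (h₁' : δ₁ = α * β)
    (h₂ : δ = α * δ₂) (h₂' : δ₂ = β * γ) (u : Cc.C α →ₗ[k] k) (S : Cc.C β →ₗ[k] X)
    (T : Cc.C γ →ₗ[k] Y) :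
    TensorProduct.map (Cc.sliceLeft h₁' u S) T ∘ₗ Cc.Δ δ₁ γ h₁ =
      Cc.sliceLeft h₂ u (TensorProduct.map S T ∘ₗ Cc.Δ β γ h₂') :=
  LinearMap.ext fun c => Cc.coassoc_apply α β γ h₁ h₁' h₂ h₂' LinearMap.id
    ((TensorProduct.lid k X).toLinearMap ∘ₗ TensorProduct.map u S) T
    (TensorProduct.lid k (X ⊗[k] Y)).toLinearMap u (TensorProduct.map S T)
    (fun a b c => by simp [TensorProduct.smul_tmul']) c

theorem map_sliceRight_comul {δ δ₁ δ₂ α β γ : G} (h₁ : δ = δ₁ * γ) (h₁' : δ₁ = α * β)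
    (h₂ : δ = α * δ₂) (h₂' : δ₂ = β * γ) (S : Cc.C α →ₗ[k] X) (u : Cc.C β →ₗ[k] k)
    (T : Cc.C γ →ₗ[k] Y) :
    TensorProduct.map (Cc.sliceRight h₁' S u) T ∘ₗ Cc.Δ δ₁ γ h₁ =
      TensorProduct.map S (Cc.sliceLeft h₂' u T) ∘ₗ Cc.Δ α δ₂ h₂ :=
  LinearMap.ext fun c => Cc.coassoc_apply α β γ h₁ h₁' h₂ h₂' LinearMap.id
    ((TensorProduct.rid k X).toLinearMap ∘ₗ TensorProduct.map S u) T
    LinearMap.id S ((TensorProduct.lid k Y).toLinearMap ∘ₗ TensorProduct.map u T)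
    (fun a b c => by simp [TensorProduct.smul_tmul]) c

theorem map_comp_sliceRight {δ δ₁ δ₂ α β γ : G} (h₁ : δ = δ₁ * γ) (h₁' : δ₁ = α * β)
    (h₂ : δ = α * δ₂) (h₂' : δ₂ = β * γ) (S : Cc.C α →ₗ[k] X) (T : Cc.C β →ₗ[k] Y)
    (u : Cc.C γ →ₗ[k] k) :
    TensorProduct.map S (Cc.sliceRight h₂' T u) ∘ₗ Cc.Δ α δ₂ h₂ =
      Cc.sliceRight h₁ (TensorProduct.map S T ∘ₗ Cc.Δ α β h₁') u :=
  LinearMap.ext fun c => (Cc.coassoc_apply α β γ h₁ h₁' h₂ h₂'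
    (TensorProduct.rid k (X ⊗[k] Y)).toLinearMap (TensorProduct.map S T) u
    LinearMap.id S ((TensorProduct.rid k Y).toLinearMap ∘ₗ TensorProduct.map T u)
    (fun a b c => by simp) c).symm

theorem map_id_id_comp {α β γ : G} (h : γ = α * β) :
    TensorProduct.map LinearMap.id LinearMap.id ∘ₗ Cc.Δ α β h = Cc.Δ α β h := by
  rw [TensorProduct.map_id, LinearMap.id_comp]

theorem strong_of_convolution_inverse (u : ∀ α : G, Cc.C α →ₗ[k] k) (v : ∀ α : G, Cc.C α⁻¹ →ₗ[k] k)
    (hvu : ∀ α, Cc.sliceLeft (inv_mul_cancel α).symm (v α) (u α) = Cc.ε) : Cc.Strong := by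
  intro α β
  have h₁ : α = α * β * β⁻¹ := by simp
  have key : ((TensorProduct.rid k _).toLinearMap ∘ₗ
      TensorProduct.map (Cc.sliceRight h₁ LinearMap.id (v β)) (u β)) ∘ₗ Cc.Δ α β rfl =
      LinearMap.id := by
    rw [LinearMap.comp_assoc, map_sliceRight_comul rfl h₁ (mul_one _).symm (inv_mul_cancel β).symm,
      hvu]
    exact Cc.counit_right _ _
  exact Function.LeftInverse.injective (g := (TensorProduct.rid k _).toLinearMap ∘ₗ
      TensorProduct.map (Cc.sliceRight h₁ LinearMap.id (v β)) (u β)) (LinearMap.congr_fun key)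

theorem biCeIso_of_central {α : G} (u : Cc.C α →ₗ[k] k) (v : Cc.C α⁻¹ →ₗ[k] k)
    (huv : Cc.sliceLeft (mul_inv_cancel α).symm u v = Cc.ε)
    (hvu : Cc.sliceLeft (inv_mul_cancel α).symm v u = Cc.ε)
    (hc : Cc.sliceLeft (mul_one α).symm u LinearMap.id =
      Cc.sliceRight (one_mul α).symm LinearMap.id u) : BiCeIso Cc α := by
  refine ⟨LinearEquiv.ofLinearMap (Cc.sliceLeft (mul_one α).symm u LinearMap.id)
    (Cc.sliceLeft (inv_mul_cancel α).symm v LinearMap.id) ?_ ?_, ?_, ?_⟩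
  · rw [comp_sliceLeft, LinearMap.comp_id,
      sliceLeft_sliceLeft (mul_one 1).symm (inv_mul_cancel α).symm, hvu, sliceLeft_counit]
  · rw [comp_sliceLeft, LinearMap.comp_id,
      sliceLeft_sliceLeft (one_mul α).symm (mul_inv_cancel α).symm, huv, sliceLeft_counit]
  · rw [LinearEquiv.toLinearMap_ofLinearMap, hc, comp_sliceRight, LinearMap.comp_id,
      map_comp_sliceRight (one_mul α).symm (one_mul 1).symm, map_id_id_comp]
  · rw [LinearEquiv.toLinearMap_ofLinearMap, comp_sliceLeft, LinearMap.comp_id,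
      map_sliceLeft_comul _ _ (mul_one α).symm (one_mul 1).symm, map_id_id_comp]

/-- A family of bicolinear isomorphisms `C_α ≃ C_e` which is the identity at `e`. -/
structure Trivialization (Cc : GCoalgebra k G) where
  φ : ∀ α : G, Cc.C α ≃ₗ[k] Cc.C 1
  φ_one : (φ 1).toLinearMap = LinearMap.id
  left : ∀ α, Cc.Δ 1 1 (one_mul 1).symm ∘ₗ (φ α).toLinearMap
      = TensorProduct.map LinearMap.id (φ α).toLinearMap ∘ₗ Cc.Δ 1 α (one_mul α).symm
  right : ∀ α, Cc.Δ 1 1 (one_mul 1).symm ∘ₗ (φ α).toLinearMap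
      = TensorProduct.map (φ α).toLinearMap LinearMap.id ∘ₗ Cc.Δ α 1 (mul_one α).symm

theorem exists_trivialization (h : ∀ α, BiCeIso Cc α) : Nonempty (Trivialization Cc) := by
  choose φ hl hr using h
  have hs : ∀ α, ((φ α).trans (φ 1).symm).toLinearMap =
      (φ 1).symm.toLinearMap ∘ₗ (φ α).toLinearMap := fun _ => rfl
  have hc : (φ 1).symm.toLinearMap ∘ₗ (φ 1).toLinearMap = LinearMap.id := by ext; simp
  have hc' : (φ 1).toLinearMap ∘ₗ (φ 1).symm.toLinearMap = LinearMap.id := by ext; simp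
  have hl' : Cc.Δ 1 1 (one_mul 1).symm ∘ₗ (φ 1).symm.toLinearMap =
      TensorProduct.map LinearMap.id (φ 1).symm.toLinearMap ∘ₗ Cc.Δ 1 1 (one_mul 1).symm := by
    have := congrArg (fun t => TensorProduct.map LinearMap.id (φ 1).symm.toLinearMap ∘ₗ t ∘ₗ
      (φ 1).symm.toLinearMap) (hl 1)
    simp only [LinearMap.comp_assoc, hc', LinearMap.comp_id] at this
    rw [this, ← LinearMap.comp_assoc, ← TensorProduct.map_comp, hc, LinearMap.comp_id,
      TensorProduct.map_id, LinearMap.id_comp]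
  have hr' : Cc.Δ 1 1 (one_mul 1).symm ∘ₗ (φ 1).symm.toLinearMap =
      TensorProduct.map (φ 1).symm.toLinearMap LinearMap.id ∘ₗ Cc.Δ 1 1 (one_mul 1).symm := by
    have := congrArg (fun t => TensorProduct.map (φ 1).symm.toLinearMap LinearMap.id ∘ₗ t ∘ₗ
      (φ 1).symm.toLinearMap) (hr 1)
    simp only [LinearMap.comp_assoc, hc', LinearMap.comp_id] at this
    rw [this, ← LinearMap.comp_assoc, ← TensorProduct.map_comp, hc, LinearMap.comp_id,
      TensorProduct.map_id, LinearMap.id_comp]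
  refine ⟨⟨fun α => (φ α).trans (φ 1).symm, ?_, fun α => ?_, fun α => ?_⟩⟩
  · rw [hs, hc]
  · rw [hs, ← LinearMap.comp_assoc, hl', LinearMap.comp_assoc, hl α, ← LinearMap.comp_assoc,
      ← TensorProduct.map_comp, LinearMap.comp_id]
  · rw [hs, ← LinearMap.comp_assoc, hr', LinearMap.comp_assoc, hr α, ← LinearMap.comp_assoc,
      ← TensorProduct.map_comp, LinearMap.comp_id]

namespace Trivialization

variable (t : Trivialization Cc)

/-- The functional `ε ∘ φ_α` on `C_α`. -/
noncomputable def u (α : G) : Cc.C α →ₗ[k] k := Cc.ε ∘ₗ (t.φ α).toLinearMap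

theorem u_one : t.u 1 = Cc.ε := by rw [u, φ_one, LinearMap.comp_id]

theorem sliceLeft_u (α : G) : Cc.sliceLeft (mul_one α).symm (t.u α) LinearMap.id = t.φ α := by
  have h := congrArg (· ∘ₗ (t.φ α).toLinearMap) (Cc.counit_left 1 (one_mul 1).symm)
  simp only [LinearMap.comp_assoc, t.right, LinearMap.id_comp] at h
  rw [← LinearMap.comp_assoc (Cc.Δ _ _ _), ← TensorProduct.map_comp, LinearMap.comp_id] at h
  exact h

theorem sliceRight_u (α : G) : Cc.sliceRight (one_mul α).symm LinearMap.id (t.u α) = t.φ α := by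
  have h := congrArg (· ∘ₗ (t.φ α).toLinearMap) (Cc.counit_right 1 (one_mul 1).symm)
  simp only [LinearMap.comp_assoc, t.left, LinearMap.id_comp] at h
  rw [← LinearMap.comp_assoc (Cc.Δ _ _ _), ← TensorProduct.map_comp, LinearMap.comp_id] at h
  exact h

/-- The map `c ↦ u_α(c_{(1,α)}) φ_β(c_{(2,β)})`. -/
noncomputable def E {α β γ : G} (h : γ = α * β) : Cc.C γ →ₗ[k] Cc.C 1 :=
  Cc.sliceLeft h (t.u α) (t.φ β).toLinearMap

variable {α β γ : G} (h : γ = α * β)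

theorem comul_comp_E : Cc.Δ 1 1 (one_mul 1).symm ∘ₗ t.E h =
    TensorProduct.map (t.φ α).toLinearMap (t.φ β).toLinearMap ∘ₗ Cc.Δ α β h := by
  rw [E, comp_sliceLeft, t.left, ← map_sliceLeft_comul h (mul_one α).symm, sliceLeft_u]

theorem map_id_E : TensorProduct.map LinearMap.id (t.E h) ∘ₗ Cc.Δ 1 γ (one_mul γ).symm =
    Cc.Δ 1 1 (one_mul 1).symm ∘ₗ t.E h := by
  rw [comul_comp_E, E, ← map_sliceRight_comul h (one_mul α).symm, sliceRight_u]

theorem map_E_id : TensorProduct.map (t.E h) LinearMap.id ∘ₗ Cc.Δ γ 1 (mul_one γ).symm =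
    Cc.Δ 1 1 (one_mul 1).symm ∘ₗ t.E h := by
  rw [E, comp_sliceLeft, t.right, map_sliceLeft_comul _ _ h]

theorem E_eq_sliceRight : t.E h = Cc.sliceRight h (t.φ α).toLinearMap (t.u β) := by
  rw [E, ← sliceRight_u, ← sliceLeft_u]
  rw [sliceRight_sliceLeft]

theorem counit_comp_E : Cc.ε ∘ₗ t.E h = Cc.sliceLeft h (t.u α) (t.u β) := by
  rw [E, comp_sliceLeft]; rfl

/-- The bicolinear endomorphism `T_{α,β}` of `C_e` with `T_{α,β} ∘ φ_{αβ} = E_{α,β}`. -/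
noncomputable def T (α β : G) : Cc.C 1 →ₗ[k] Cc.C 1 :=
  t.E (rfl : α * β = α * β) ∘ₗ (t.φ (α * β)).symm.toLinearMap

theorem T_comp_φ : t.T α β ∘ₗ (t.φ γ).toLinearMap = t.E h := by
  subst h
  ext; simp [T]

theorem isBicolinear_T (α β : G) : IsBicolinear (t.T α β) := by
  have hinj : ∀ {P Q : Cc.C 1 →ₗ[k] Cc.C 1 ⊗[k] Cc.C 1},
      P ∘ₗ (t.φ (α * β)).toLinearMap = Q ∘ₗ (t.φ (α * β)).toLinearMap → P = Q := fun h =>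
    (LinearMap.cancel_right (t.φ (α * β)).surjective).mp h
  constructor <;> apply hinj
  · change Cc.Δ 1 1 (one_mul 1).symm ∘ₗ t.T α β ∘ₗ _ =
      (_ ∘ₗ Cc.Δ 1 1 (one_mul 1).symm) ∘ₗ _
    rw [T_comp_φ _ rfl, LinearMap.comp_assoc, t.left, ← LinearMap.comp_assoc,
      ← TensorProduct.map_comp, T_comp_φ _ rfl, LinearMap.comp_id, map_id_E]
  · change Cc.Δ 1 1 (one_mul 1).symm ∘ₗ t.T α β ∘ₗ _ =
      (_ ∘ₗ Cc.Δ 1 1 (one_mul 1).symm) ∘ₗ _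
    rw [T_comp_φ _ rfl, LinearMap.comp_assoc, t.right, ← LinearMap.comp_assoc,
      ← TensorProduct.map_comp, T_comp_φ _ rfl, LinearMap.comp_id, map_E_id]

theorem T_injective (hs : Cc.Strong) (α β : G) : Function.Injective (t.T α β) := by
  have hE : Function.Injective (t.E (rfl : α * β = α * β)) := by
    have h : Function.Injective (Cc.Δ 1 1 (one_mul 1).symm ∘ₗ t.E (rfl : α * β = α * β)) := by
      rw [comul_comp_E]
      exact (TensorProduct.congr (t.φ α) (t.φ β)).injective.comp (hs α β)
    exact Function.Injective.of_comp h
  exact hE.comp (t.φ (α * β)).symm.injective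

theorem T_one_left (β : G) : t.T 1 β = LinearMap.id := by
  rw [← LinearMap.cancel_right (t.φ β).surjective, T_comp_φ _ (one_mul β).symm, E, u_one,
    sliceLeft_counit, LinearMap.id_comp]

theorem T_one_right (α : G) : t.T α 1 = LinearMap.id := by
  rw [← LinearMap.cancel_right (t.φ α).surjective, T_comp_φ _ (mul_one α).symm, E, φ_one,
    sliceLeft_u, LinearMap.id_comp]

theorem counit_comp_T_comp_T (α β γ : G) :
    Cc.ε ∘ₗ t.T β γ ∘ₗ t.T α (β * γ) = Cc.ε ∘ₗ t.T α β ∘ₗ t.T (α * β) γ := by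
  rw [← LinearMap.cancel_right (t.φ (α * β * γ)).surjective]
  simp only [LinearMap.comp_assoc]
  rw [T_comp_φ _ rfl, T_comp_φ _ (mul_assoc α β γ), E_eq_sliceRight _ rfl, E, comp_sliceLeft,
    comp_sliceRight, T_comp_φ _ rfl, T_comp_φ _ rfl, comp_sliceLeft, comp_sliceRight,
    counit_comp_E, counit_comp_E, ← sliceLeft_eq_sliceRight, ← sliceLeft_sliceLeft]

/-- The crossed coproduct data attached to a trivialization and a family `g`. -/
noncomputable def crossedData (g : G → G → Cc.C 1 →ₗ[k] k) : CrossedData k G where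
  C := Cc.C 1
  lam _ := CoalgHom.id k (Cc.C 1)
  f α β := Coalgebra.counit ∘ₗ t.T α β
  g := g

end Trivialization

theorem exists_normalized_crossedData (hs : Cc.Strong) (hb : ∀ α, BiCeIso Cc α) :
    ∃ D : CrossedData k G, D.IsFactorSet ∧ D.Normalized ∧
      (∀ α : G, (D.lam α).toLinearMap = LinearMap.id) ∧ IsoToCrossed Cc D := by
  obtain ⟨t⟩ := exists_trivialization hb
  choose g hfg hgf using fun α β => (t.isBicolinear_T α β).exists_convF_inverse (t.T_injective hs α β)
  have hlam : ∀ α, ((t.crossedData g).lam α).toLinearMap = LinearMap.id := fun _ => rfl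
  have hf₁ : ∀ α, (t.crossedData g).f 1 α = Coalgebra.counit := fun α => by
    change Coalgebra.counit ∘ₗ t.T 1 α = _
    rw [t.T_one_left, LinearMap.comp_id]
    rfl
  have hf₂ : ∀ α, (t.crossedData g).f α 1 = Coalgebra.counit := fun α => by
    change Coalgebra.counit ∘ₗ t.T α 1 = _
    rw [t.T_one_right, LinearMap.comp_id]
    rfl
  have hg : (t.crossedData g).g 1 1 = Coalgebra.counit := by
    have h : convF k _ ((t.crossedData g).f 1 1) ((t.crossedData g).g 1 1) = Coalgebra.counit :=
      hfg 1 1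
    rwa [hf₁, counit_convF] at h
  refine ⟨t.crossedData g, ⟨⟨hfg 1 1, hgf 1 1, ?_⟩, fun α β => ⟨hfg α β, hgf α β⟩, ?_, ?_, ?_⟩,
    fun α => ⟨hf₂ α, hf₁ α⟩, hlam, t.φ, ?_, ?_⟩
  · rw [hlam, hf₁, hg, counit_convFM, convMF_counit]
  · intro α
    rw [hf₁, hf₁, hf₂, hlam, LinearMap.comp_id]
    exact ⟨rfl, rfl⟩
  · intro α β γ
    rw [hlam, LinearMap.comp_id]
    exact ((t.isBicolinear_T α (β * γ)).convF_comp_counit (S := t.T β γ)).trans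
      ((t.counit_comp_T_comp_T α β γ).trans
        ((t.isBicolinear_T (α * β) γ).convF_comp_counit (S := t.T α β)).symm)
  · intro α β
    rw [hlam, hlam, hlam, LinearMap.comp_id]
    exact (t.isBicolinear_T α β).convMF_id.trans (t.isBicolinear_T α β).convFM_id.symm
  · rw [hg, t.φ_one]
    rfl
  · intro γ α β h
    have hd : (t.crossedData g).delta α β = Cc.Δ 1 1 (one_mul 1).symm ∘ₗ t.T α β := by
      rw [CrossedData.delta, hlam]
      refine Eq.trans ?_ (t.isBicolinear_T α β).left.symm
      exact congrArg (fun S => TensorProduct.map LinearMap.id S ∘ₗ Coalgebra.comul)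
        (t.isBicolinear_T α β).convMF_id
    rw [hd]
    exact (t.comul_comp_E h).symm.trans
      (congrArg (Cc.Δ 1 1 (one_mul 1).symm ∘ₗ ·) (t.T_comp_φ h).symm)

end GCoalgebra

namespace CrossedData

variable {D : CrossedData k G}

theorem map_comp_delta (hlam : ∀ α, (D.lam α).toLinearMap = LinearMap.id)
    {X Y : Type u} [AddCommGroup X] [Module k X] [AddCommGroup Y]
    [Module k Y] (a : D.C →ₗ[k] X) (b : D.C →ₗ[k] Y) (α β : G) :
    TensorProduct.map a b ∘ₗ D.delta α β =
      TensorProduct.map a (b ∘ₗ convMF k D.C LinearMap.id (D.f α β)) ∘ₗ Coalgebra.comul := by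
  rw [delta, hlam, ← LinearMap.comp_assoc, ← TensorProduct.map_comp, LinearMap.comp_id]

theorem mul'_map_comp_delta (hlam : ∀ α, (D.lam α).toLinearMap = LinearMap.id)
    (a b : D.C →ₗ[k] k) (α β : G) :
    LinearMap.mul' k k ∘ₗ TensorProduct.map a b ∘ₗ D.delta α β =
      convF k D.C a (convF k D.C b (D.f α β)) := by
  rw [map_comp_delta hlam, comp_convMF_id]
  rfl

theorem lid_map_counit_comp_delta (hlam : ∀ α, (D.lam α).toLinearMap = LinearMap.id)
    (α β : G) :
    (TensorProduct.lid k D.C).toLinearMap ∘ₗ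
      TensorProduct.map Coalgebra.counit LinearMap.id ∘ₗ D.delta α β =
      convMF k D.C LinearMap.id (D.f α β) := by
  rw [map_comp_delta hlam, LinearMap.id_comp]
  exact counit_convFM _

theorem rid_map_counit_comp_delta (hlam : ∀ α, (D.lam α).toLinearMap = LinearMap.id)
    (α β : G) :
    (TensorProduct.rid k D.C).toLinearMap ∘ₗ
      TensorProduct.map LinearMap.id Coalgebra.counit ∘ₗ D.delta α β =
      convMF k D.C LinearMap.id (D.f α β) := by
  rw [map_comp_delta hlam, comp_convMF_id, counit_convF]
  rfl

theorem IsFactorSet.f_one_right (hD : D.IsFactorSet)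
    (hlam : ∀ α, (D.lam α).toLinearMap = LinearMap.id) (α : G) : D.f α 1 = D.f 1 α := by
  obtain ⟨-, -, hCU, -, -⟩ := hD
  rw [(hCU α).2, (hCU α).1, hlam, LinearMap.comp_id]

theorem IsFactorSet.f_inv_comm (hD : D.IsFactorSet)
    (hlam : ∀ α, (D.lam α).toLinearMap = LinearMap.id) (α : G) : D.f α⁻¹ α = D.f α α⁻¹ := by
  have h₁ := hD.f_one_right hlam α
  obtain ⟨hW, -, hCU, hC, -⟩ := hD
  have h := congrArg (fun t => convF k D.C t (D.g 1 1)) (hC α α⁻¹ α)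
  rwa [hlam, LinearMap.comp_id, inv_mul_cancel, mul_inv_cancel, h₁, (hCU α).1, convF_assoc,
    convF_assoc, hW.1, convF_counit, convF_counit] at h

end CrossedData

theorem IsoToCrossed.exists_central_convolution_inverse {Cc : GCoalgebra k G}
    {D : CrossedData k G} (hiso : IsoToCrossed Cc D) (hD : D.IsFactorSet)
    (hlam : ∀ α, (D.lam α).toLinearMap = LinearMap.id) :
    ∃ (u : ∀ α : G, Cc.C α →ₗ[k] k) (v : ∀ α : G, Cc.C α⁻¹ →ₗ[k] k),
      (∀ α : G,
        LinearMap.mul' k k ∘ₗ TensorProduct.map (u α) (v α) ∘ₗ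
            Cc.Δ α α⁻¹ (mul_inv_cancel α).symm = Cc.ε ∧
        LinearMap.mul' k k ∘ₗ TensorProduct.map (v α) (u α) ∘ₗ
            Cc.Δ α⁻¹ α (inv_mul_cancel α).symm = Cc.ε) ∧
      ∀ α : G, Cc.sliceLeft (mul_one α).symm (u α) LinearMap.id =
        Cc.sliceRight (one_mul α).symm LinearMap.id (u α) := by
  obtain ⟨φ, hε, hφ⟩ := hiso
  have hmap : ∀ {X Y : Type u} [AddCommGroup X] [Module k X] [AddCommGroup Y] [Module k Y]
      (a : D.C →ₗ[k] X) (b : D.C →ₗ[k] Y) {α β γ : G} (h : γ = α * β),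
      TensorProduct.map (a ∘ₗ (φ α).toLinearMap) (b ∘ₗ (φ β).toLinearMap) ∘ₗ Cc.Δ α β h =
        TensorProduct.map a b ∘ₗ D.delta α β ∘ₗ (φ γ).toLinearMap := by
    intro X Y _ _ _ _ a b α β γ h
    rw [TensorProduct.map_comp, LinearMap.comp_assoc, hφ α β h]
  have hmul : ∀ (a b : D.C →ₗ[k] k) {α β γ : G} (h : γ = α * β),
      LinearMap.mul' k k ∘ₗ TensorProduct.map (a ∘ₗ (φ α).toLinearMap) (b ∘ₗ (φ β).toLinearMap) ∘ₗ
        Cc.Δ α β h = convF k D.C a (convF k D.C b (D.f α β)) ∘ₗ (φ γ).toLinearMap := by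
    intro a b α β γ h
    rw [hmap, ← CrossedData.mul'_map_comp_delta hlam]
    rfl
  have hg : ∀ α, convF k D.C (convF k D.C (D.g 1 1) (D.g α α⁻¹)) (D.f α α⁻¹) = D.g 1 1 :=
    fun α => by rw [convF_assoc, (hD.2.1 α α⁻¹).2, convF_counit]
  refine ⟨fun α => Coalgebra.counit ∘ₗ (φ α).toLinearMap,
    fun α => convF k D.C (D.g 1 1) (D.g α α⁻¹) ∘ₗ (φ α⁻¹).toLinearMap,
    fun α => ⟨?_, ?_⟩, fun α => ?_⟩
  · rw [hmul, counit_convF, hg, hε]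
  · rw [hmul, counit_convF, hD.f_inv_comm hlam, hg, hε]
  · rw [← LinearMap.cancel_left (f := (φ 1).toLinearMap) (φ 1).injective,
      GCoalgebra.comp_sliceLeft, GCoalgebra.comp_sliceRight, GCoalgebra.sliceLeft,
      GCoalgebra.sliceRight, LinearMap.comp_id, ← LinearMap.id_comp (φ 1).toLinearMap, hmap, hmap]
    have h₁ := CrossedData.lid_map_counit_comp_delta hlam α 1
    have h₂ := CrossedData.rid_map_counit_comp_delta hlam 1 α
    rw [hD.f_one_right hlam, ← h₂] at h₁
    exact congrArg (· ∘ₗ (φ α).toLinearMap) h₁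

/-- **Theorem 3.6.** For a `G`-coalgebra `C̲` the following are equivalent:
(1) there is a convolution invertible `u̲ : C̲ → k⟨G⟩` with
`u_α(c_{(1,α)}) c_{(2,e)} = c_{(1,e)} u_α(c_{(2,α)})` for all `α` and `c ∈ C_α`;
(2) `C̲` is isomorphic to a crossed coproduct `C ⋊_f k⟨G⟩` with `λ_α = id` for all `α`;
(3) `C̲` is isomorphic to a crossed coproduct with `f` normalized and `λ_α = id`;
(4) `C̲` is strong and every `C_α` is isomorphic to `C_e` as a `C_e`-bicomodule. -/
theorem central_cocleft_tfae {k G : Type u} [Field k] [Group G] (Cc : GCoalgebra k G) :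
    List.TFAE
      [ ∃ (u : ∀ α : G, Cc.C α →ₗ[k] k) (v : ∀ α : G, Cc.C α⁻¹ →ₗ[k] k),
          (∀ α : G,
            LinearMap.mul' k k ∘ₗ TensorProduct.map (u α) (v α) ∘ₗ
                Cc.Δ α α⁻¹ (mul_inv_cancel α).symm = Cc.ε ∧
            LinearMap.mul' k k ∘ₗ TensorProduct.map (v α) (u α) ∘ₗ
                Cc.Δ α⁻¹ α (inv_mul_cancel α).symm = Cc.ε) ∧
          (∀ α : G,
            (TensorProduct.lid k (Cc.C 1)).toLinearMap ∘ₗ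
                TensorProduct.map (u α) LinearMap.id ∘ₗ Cc.Δ α 1 (mul_one α).symm
              = (TensorProduct.rid k (Cc.C 1)).toLinearMap ∘ₗ
                TensorProduct.map LinearMap.id (u α) ∘ₗ Cc.Δ 1 α (one_mul α).symm),
        ∃ D : CrossedData k G, D.IsFactorSet ∧
          (∀ α : G, (D.lam α).toLinearMap = LinearMap.id) ∧ IsoToCrossed Cc D,
        ∃ D : CrossedData k G, D.IsFactorSet ∧ D.Normalized ∧
          (∀ α : G, (D.lam α).toLinearMap = LinearMap.id) ∧ IsoToCrossed Cc D,
        Cc.Strong ∧ ∀ α : G, BiCeIso Cc α ] := by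
  tfae_have 1 → 4 := by
    rintro ⟨u, v, huv, hc⟩
    have huv₁ := fun α => (GCoalgebra.mul'_comp_map _ _ _).symm.trans (huv α).1
    have huv₂ := fun α => (GCoalgebra.mul'_comp_map _ _ _).symm.trans (huv α).2
    exact ⟨GCoalgebra.strong_of_convolution_inverse u v huv₂,
      fun α => GCoalgebra.biCeIso_of_central (u α) (v α) (huv₁ α) (huv₂ α) (hc α)⟩
  tfae_have 4 → 3 := fun h => GCoalgebra.exists_normalized_crossedData h.1 h.2
  tfae_have 3 → 2 := fun ⟨D, hD, _, hlam, hiso⟩ => ⟨D, hD, hlam, hiso⟩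
  tfae_have 2 → 1 := fun ⟨_, hD, hlam, hiso⟩ => hiso.exists_central_convolution_inverse hD hlam
  tfae_finish
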